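/- Let n ≥ 4 and let M = M_n[1,ℓ] be a rank-2 Schubert matroid with 1 ≤ ℓ < n−2. Then the h*-vector of P_M satisfies h*₀ = 1, h*₀ + h*₁ = #{π ∈ P_{1,n−1} : d(π) ≤ ℓ and ig(π) = 0}, and for every k ≥ 2, h*_k = #{π ∈ P_{1,n−1} : d(π) ≤ ℓ and ig(π) = k−1}. -/

import Mathlib

/-!
Statement 18: A combinatorial interpretation of the `h*`-vector of a rank-2 Schubert
matroid `M_n[1,ℓ]` with `1 ≤ ℓ < n-2`: `h*₀ = 1`, `h*₀ + h*₁` counts permutations of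
`[n-1]` with one descent in position `≤ ℓ` and no initial gaps, and `h*_k` (for
`k ≥ 2`) counts those with descent position `≤ ℓ` and exactly `k-1` initial gaps.
-/

open scoped Classical Pointwise

/-- The height of the lattice path associated to `A ⊆ [n]` after `i` steps:
the number of north steps (elements of `A`) among the first `i` steps. -/
def pathHeight {n : ℕ} (A : Finset (Fin n)) (i : ℕ) : ℕ :=
  (A.filter fun j => j.val < i).card

/-- The 0/1 indicator vector of a subset of `[n]`. -/
def indVec {n : ℕ} (B : Finset (Fin n)) : Fin n → ℝ :=
  fun i => if i ∈ B then 1 else 0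

/-- Height after `i` steps of the upper path `U` of `M_n[k,ℓ]`, which has north steps
at positions `1` and `n - ℓ`. -/
def upperHt (n l i : ℕ) : ℕ :=
  (if 1 ≤ i then 1 else 0) + (if n - l ≤ i then 1 else 0)

/-- Height after `i` steps of the lower path `L` of `M_n[k,ℓ]`, which has its two
north steps at the end of the diagram (positions `n - k` and `n`). -/
def lowerHt (n k i : ℕ) : ℕ :=
  (if n - k ≤ i then 1 else 0) + (if n ≤ i then 1 else 0)

/-- The bases of the rank-2 lattice path matroid `M_n[k,ℓ]`: all `2`-subsets of `[n]`
whose lattice path lies weakly between the lower and upper paths. -/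
noncomputable def MklBases (n k l : ℕ) : Finset (Finset (Fin n)) :=
  Finset.univ.filter fun B => B.card = 2 ∧
    ∀ i ∈ Finset.range (n + 1),
      lowerHt n k i ≤ pathHeight B i ∧ pathHeight B i ≤ upperHt n l i

/-- The matroid polytope of `M_n[k,ℓ]`. -/
noncomputable def MklPolytope (n k l : ℕ) : Set (Fin n → ℝ) :=
  convexHull ℝ {x | ∃ B ∈ MklBases n k l, x = indVec B}

/-- The number of lattice (integer) points of a subset of `ℝⁿ`. -/
noncomputable def latticeCount {n : ℕ} (S : Set (Fin n → ℝ)) : ℕ :=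
  Set.ncard {x ∈ S | ∀ i, ∃ m : ℤ, x i = (m : ℝ)}

/-- The normalized volume of a `d`-dimensional lattice polytope `P`: the `d`-th finite
difference at `0` of the Ehrhart counting function, i.e. `d! · vol(P)`. -/
noncomputable def normVol {n : ℕ} (P : Set (Fin n → ℝ)) (d : ℕ) : ℤ :=
  ∑ j ∈ Finset.range (d + 1),
    (-1 : ℤ) ^ j * (d.choose j : ℤ) * (latticeCount (((d - j : ℕ) : ℝ) • P) : ℤ)

/-- `σ_n(k,ℓ)`: the normalized volume of the rank-2 lattice path matroid polytope
`P_{M_n[k,ℓ]}`, set to `0` when the parameters are out of range. -/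
noncomputable def sigmaVol (n k l : ℕ) : ℤ :=
  if 1 ≤ k ∧ k ≤ l ∧ l ≤ n - 2 then normVol (MklPolytope n k l) (n - 1) else 0

/-- `h` is the `h*`-vector of the lattice polytope `P` of dimension `d`:
`L_P(t) = ∑_{k=0}^{d} h_k · C(t + d - k, d)` for all `t ≥ 0`, and `h` vanishes beyond
degree `d`.  This encodes `∑_{t≥0} L_P(t) z^t = (∑_k h_k z^k)/(1-z)^{d+1}`. -/
def IsHStarVector {n : ℕ} (P : Set (Fin n → ℝ)) (d : ℕ) (h : ℕ → ℕ) : Prop :=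
  (∀ t : ℕ, latticeCount ((t : ℝ) • P) =
      ∑ k ∈ Finset.range (d + 1), h k * Nat.choose (t + d - k) d) ∧
  ∀ k, d < k → h k = 0

/-- The one-line notation of a permutation of `[m]` (0-based positions and values),
extended by `0` outside the range. -/
def oneLine {m : ℕ} (π : Equiv.Perm (Fin m)) (i : ℕ) : ℕ :=
  if h : i < m then (π ⟨i, h⟩ : ℕ) else 0

/-- The permutation `π` of `[m]` has a descent at (0-based) position `i`. -/
def DescentAt {m : ℕ} (π : Equiv.Perm (Fin m)) (i : ℕ) : Prop :=
  i + 1 < m ∧ oneLine π (i + 1) < oneLine π i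

/-- The number of descents of a permutation of `[m]`. -/
def descentCount {m : ℕ} (π : Equiv.Perm (Fin m)) : ℕ :=
  ((Finset.range m).filter fun i => i + 1 < m ∧ oneLine π (i + 1) < oneLine π i).card

/-- The number of initial gaps of a permutation `π` of `[m]`: the number of positions
`i` strictly before a descent of `π` with `π_{i+1} ≠ π_i + 1`. -/
def initialGaps {m : ℕ} (π : Equiv.Perm (Fin m)) : ℕ :=
  ((Finset.range m).filter fun i =>
    (∃ d ∈ Finset.range m, (d + 1 < m ∧ oneLine π (d + 1) < oneLine π d) ∧ i < d) ∧
      oneLine π (i + 1) ≠ oneLine π i + 1).card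

/-- Summation by parts for a convolution of binomial coefficients truncated at `r`. -/
theorem sum_choose_mul_choose_succ (m l N r : ℕ) (hr : r ≤ N) :
    ∑ s ∈ Finset.range (r + 1), (s + m).choose m * (N - s + (l + 1)).choose (l + 1) =
      ∑ s ∈ Finset.range (r + 1), (s + (m + 1)).choose (m + 1) * (N - s + l).choose l +
        (r + (m + 1)).choose (m + 1) * (N - r + l).choose (l + 1) := by
  induction r with
  | zero => simp [← add_assoc, Nat.choose_succ_succ' (N + l) l]
  | succ r ih =>
    obtain ⟨q, rfl⟩ := Nat.exists_eq_add_of_le hr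
    rw [Finset.sum_range_succ, ih (by omega), Finset.sum_range_succ _ (r + 1)]
    have e1 : r + 1 + q - r + l = q + l + 1 := by omega
    have e2 : r + 1 + q - (r + 1) = q := by omega
    have e3 : r + 1 + (m + 1) = (r + 1 + m) + 1 := by omega
    have e4 : r + (m + 1) = r + 1 + m := by omega
    rw [e1, e2, e3, e4, ← add_assoc q l 1, Nat.choose_succ_succ' (q + l) l,
      Nat.choose_succ_succ' (r + 1 + m) m]
    ring

/-- A truncated convolution of binomial coefficients as a sum of products. -/
theorem sum_choose_mul_choose_eq (t m l : ℕ) :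
    ∑ s ∈ Finset.range (t + 1), (s + m).choose m * (2 * t - s + l).choose l =
      (t + (m + l + 1)).choose (m + l + 1) +
        ∑ i ∈ Finset.range l,
          (t + (m + l - i)).choose (m + l - i) * (t + i).choose (i + 1) := by
  induction l generalizing m with
  | zero => simpa [add_assoc] using Nat.sum_range_add_choose t m
  | succ l ih =>
    rw [sum_choose_mul_choose_succ m l (2 * t) t (by omega), ih, Finset.sum_range_succ]
    have e1 : m + (l + 1) - l = m + 1 := by omega
    have e2 : 2 * t - t + l = t + l := by omega
    have e3 : m + (l + 1) = m + 1 + l := by omega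
    rw [e1, e2, e3, add_assoc]

theorem choose_mul_choose_eq_aux (m i t k : ℕ) (hk : k ≤ i) :
    (t + m + 1) * (t + m + i - k).choose (m + i + 1) =
      (i - k) * (t + m + i - k).choose (m + i + 2) +
        (m + k + 2) * (t + m + i - k + 1).choose (m + i + 2) := by
  obtain ⟨j, rfl⟩ := Nat.exists_eq_add_of_le hk
  have e : t + m + (k + j) - k = t + m + j := by omega
  rw [e, Nat.add_sub_cancel_left, Nat.choose_succ_succ' (t + m + j) (m + (k + j) + 1)]
  rcases Nat.lt_or_ge t (k + 1) with h | h
  · rw [Nat.choose_eq_zero_of_lt (show t + m + j < m + (k + j) + 1 by omega),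
      Nat.choose_eq_zero_of_lt (show t + m + j < m + (k + j) + 2 by omega)]
    simp
  · obtain ⟨q, rfl⟩ := Nat.exists_eq_add_of_le h
    have := Nat.choose_succ_right_eq (k + 1 + q + m + j) (m + (k + j) + 1)
    rw [show k + 1 + q + m + j - (m + (k + j) + 1) = q by omega] at this
    nlinarith [this]

/-- A product of binomial coefficients expanded in the basis `t ↦ C(t + a, m + i + 1)`. -/
theorem choose_mul_choose_eq_sum (m i t : ℕ) :
    (t + m).choose m * (t + i).choose (i + 1) =
      ∑ k ∈ Finset.range (i + 1),
        i.choose k * (m + 1).choose (k + 1) * (t + m + i - k).choose (m + i + 1) := by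
  induction m with
  | zero =>
    rw [Finset.sum_range_succ']
    simp [Nat.choose_eq_zero_of_lt]
  | succ m ih =>
    have key : (m + 1) * ((t + (m + 1)).choose (m + 1)) = (t + m + 1) * (t + m).choose m := by
      have := Nat.add_one_mul_choose_eq (t + m) m
      rw [← add_assoc]; linarith
    apply Nat.eq_of_mul_eq_mul_left (Nat.succ_pos m)
    rw [Nat.succ_eq_add_one, ← mul_assoc, key, mul_assoc, ih, Finset.mul_sum]
    have h1 : ∀ k ∈ Finset.range (i + 1),
        (t + m + 1) * (i.choose k * (m + 1).choose (k + 1) *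
          (t + m + i - k).choose (m + i + 1)) =
        (m + k + 2) * i.choose k * (m + 1).choose (k + 1) *
          (t + m + i - k + 1).choose (m + i + 2) +
        (k + 1) * i.choose (k + 1) * (m + 1).choose (k + 1) *
          (t + m + i - k).choose (m + i + 2) := by
      intro k hk
      have hk' : k ≤ i := by simpa [Nat.lt_succ_iff] using hk
      have := choose_mul_choose_eq_aux m i t k hk'
      have h2 := Nat.choose_succ_right_eq i k
      calc _ = i.choose k * (m + 1).choose (k + 1) *
            ((t + m + 1) * (t + m + i - k).choose (m + i + 1)) := by ring
        _ = _ := by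
          rw [this]
          linear_combination (m + 1).choose (k + 1) * (t + m + i - k).choose (m + i + 2) * h2.symm
    rw [Finset.sum_congr rfl h1, Finset.sum_add_distrib, Finset.sum_range_succ',
      Finset.sum_range_succ (fun k => (k + 1) * i.choose (k + 1) * (m + 1).choose (k + 1) *
          (t + m + i - k).choose (m + i + 2)), Finset.sum_range_succ' _ i]
    have h3 : ∀ k, (m + k + 3) * (m + 1).choose (k + 2) + (k + 1) * (m + 1).choose (k + 1) =
        (m + 1) * (m + 2).choose (k + 2) := by
      intro k
      have h4 := Nat.choose_succ_right_eq (m + 1) (k + 1)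
      rw [Nat.choose_succ_succ' (m + 1) (k + 1)]
      rcases Nat.lt_or_ge m k with h | h
      · simp [Nat.choose_eq_zero_of_lt (show m + 1 < k + 1 by omega),
          Nat.choose_eq_zero_of_lt (show m + 1 < k + 1 + 1 by omega)]
      · obtain ⟨q, rfl⟩ := Nat.exists_eq_add_of_le h
        rw [show k + q + 1 - (k + 1) = q by omega] at h4
        linear_combination h4
    have h5 : ∀ k ∈ Finset.range i,
        (m + (k + 1) + 2) * i.choose (k + 1) * (m + 1).choose (k + 1 + 1) *
            (t + m + i - (k + 1) + 1).choose (m + i + 2) +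
          (k + 1) * i.choose (k + 1) * (m + 1).choose (k + 1) *
            (t + m + i - k).choose (m + i + 2) =
        (m + 1) * (i.choose (k + 1) * (m + 1 + 1).choose (k + 1 + 1) *
          (t + (m + 1) + i - (k + 1)).choose (m + 1 + i + 1)) := by
      intro k hk
      have hk' : k < i := by simpa using hk
      rw [show t + m + i - (k + 1) + 1 = t + m + i - k by omega,
        show t + (m + 1) + i - (k + 1) = t + m + i - k by omega,
        show m + 1 + i + 1 = m + i + 2 by omega]
      linear_combination i.choose (k + 1) * (t + m + i - k).choose (m + i + 2) * h3 k
    rw [mul_add, Finset.mul_sum, ← Finset.sum_congr rfl h5, Finset.sum_add_distrib,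
      show m + 1 + i + 1 = m + i + 2 by omega, show t + (m + 1) + i - 0 = t + m + i + 1 by omega]
    simp
    ring

/-- Stars and bars. -/
theorem card_piAntidiag_eq_choose {ι : Type*} [DecidableEq ι] (s : Finset ι) (m N : ℕ)
    (hs : s.card = m + 1) : (Finset.piAntidiag s N).card = (N + m).choose m := by
  induction m generalizing s N with
  | zero =>
    obtain ⟨a, rfl⟩ := Finset.card_eq_one.1 hs
    rw [← Finset.map_sym_eq_piAntidiag]
    simp
  | succ m ih =>
    obtain ⟨a, u, ha, rfl, hu⟩ := Finset.card_eq_succ.1 hs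
    rw [← Finset.cons_eq_insert a u ha, Finset.piAntidiag_cons ha, Finset.card_disjiUnion]
    simp only [Finset.card_map]
    rw [Finset.sum_congr rfl fun p _ => ih u p.2 hu,
      Finset.Nat.sum_antidiagonal_eq_sum_range_succ_mk]
    rw [← Finset.sum_range_reflect]
    rw [Finset.sum_congr rfl (g := fun k => (k + m).choose m)]
    · rw [Nat.sum_range_add_choose, add_assoc]
    · intro k hk
      have : k < N + 1 := by simpa using hk
      rw [show N - (N.succ - 1 - k) = k by omega]

/-- Tuples with prescribed sums over a set of coordinates and over its complement. -/
theorem card_filter_piAntidiag_sum_eq {ι : Type*} [Fintype ι] [DecidableEq ι] (s : Finset ι)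
    (N a : ℕ) (ha : a ≤ N) :
    ((Finset.piAntidiag Finset.univ N).filter fun f : ι → ℕ => ∑ i ∈ s, f i = a).card =
      (Finset.piAntidiag s a).card * (Finset.piAntidiag sᶜ (N - a)).card := by
  rw [← Finset.card_product]
  refine Finset.card_nbij' (fun f => (s.piecewise f 0, sᶜ.piecewise f 0))
    (fun p => s.piecewise p.1 p.2) ?_ ?_ ?_ ?_
  · intro f hf
    have hf' : ∑ i, f i = N ∧ ∑ i ∈ s, f i = a := by simpa using hf
    have h1 := Finset.sum_add_sum_compl s f
    simp only [Finset.coe_product, Set.mem_prod, Finset.mem_coe, Finset.mem_piAntidiag]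
    refine ⟨⟨?_, fun i hi => ?_⟩, ?_, fun i hi => ?_⟩
    · rw [← hf'.2]
      exact Finset.sum_congr rfl fun i hi => by simp [hi]
    · by_contra h
      simp [h] at hi
    · have : ∑ i ∈ sᶜ, sᶜ.piecewise f 0 i = ∑ i ∈ sᶜ, f i :=
        Finset.sum_congr rfl fun i hi => by simp [Finset.piecewise, hi]
      exact this.trans (by omega)
    · by_contra h
      simp [Finset.piecewise, h] at hi
  · rintro ⟨f, g⟩ hp
    simp only [Finset.coe_product, Set.mem_prod, Finset.mem_coe, Finset.mem_piAntidiag] at hp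
    obtain ⟨⟨h1, -⟩, h2, -⟩ := hp
    have h3 : ∑ i ∈ s, s.piecewise f g i = a := by
      rw [← h1]
      exact Finset.sum_congr rfl fun i hi => by simp [hi]
    have h4 : ∑ i ∈ sᶜ, s.piecewise f g i = N - a := by
      rw [← h2]
      exact Finset.sum_congr rfl fun i hi => by
        simp [Finset.piecewise, Finset.mem_compl.1 hi]
    have h5 := Finset.sum_add_sum_compl s (s.piecewise f g)
    rw [h3, h4, Nat.add_sub_cancel' ha] at h5
    exact Finset.mem_coe.2 (Finset.mem_filter.2 ⟨Finset.mem_piAntidiag.2 ⟨h5.symm, by simp⟩, h3⟩)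
  · intro f _
    funext i
    by_cases hi : i ∈ s <;> simp [Finset.piecewise, hi]
  · rintro ⟨f, g⟩ hp
    simp only [Finset.coe_product, Set.mem_prod, Finset.mem_coe, Finset.mem_piAntidiag] at hp
    obtain ⟨⟨-, h1⟩, -, h2⟩ := hp
    ext i
    · by_cases hi : i ∈ s
      · simp [hi]
      · simpa [hi, eq_comm] using mt (h1 i) hi
    · by_cases hi : i ∈ s
      · simpa [Finset.piecewise, hi, eq_comm] using mt (h2 i)
      · simp [Finset.piecewise, hi]

/-- Tuples with one large coordinate. -/
theorem card_filter_piAntidiag_lt {ι : Type*} [Fintype ι] [DecidableEq ι] (i : ι) (u q : ℕ) :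
    ((Finset.piAntidiag Finset.univ (u + 1 + q)).filter fun f : ι → ℕ => u < f i).card =
      (Finset.piAntidiag (Finset.univ : Finset ι) q).card := by
  symm
  refine Finset.card_nbij' (fun f => f + Pi.single i (u + 1)) (fun f => f - Pi.single i (u + 1))
    ?_ ?_ ?_ ?_
  · intro f hf
    have hf' : ∑ i, f i = q := by simpa using hf
    simp [Finset.sum_add_distrib, hf']
    omega
  · intro f hf
    have hf' : ∑ i, f i = u + 1 + q ∧ u < f i := by simpa using hf
    have h1 : ∑ j, (f j - (Pi.single i (u + 1) : ι → ℕ) j) + ∑ j, (Pi.single i (u + 1) : ι → ℕ) j =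
        ∑ j, f j := by
      rw [← Finset.sum_add_distrib]
      refine Finset.sum_congr rfl fun j _ => Nat.sub_add_cancel ?_
      by_cases hj : j = i
      · subst hj; simpa using hf'.2
      · simp [hj]
    rw [Finset.sum_pi_single'] at h1
    simp at h1 ⊢
    omega
  · intro f _
    simp
  · intro f hf
    have hf' : ∑ i, f i = u + 1 + q ∧ u < f i := by simpa using hf
    funext j
    refine Nat.sub_add_cancel ?_
    by_cases hj : j = i
    · subst hj; simpa using hf'.2
    · simp [hj]

theorem card_filter_piAntidiag_sum_le {ι : Type*} [Fintype ι] [DecidableEq ι] (s : Finset ι)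
    (m l t : ℕ) (hs : s.card = m + 1) (hs' : sᶜ.card = l + 1) :
    ((Finset.piAntidiag Finset.univ (2 * t)).filter fun f : ι → ℕ => ∑ i ∈ s, f i ≤ t).card =
      ∑ a ∈ Finset.range (t + 1), (a + m).choose m * (2 * t - a + l).choose l := by
  rw [Finset.card_eq_sum_card_fiberwise (f := fun f => ∑ i ∈ s, f i)
    (t := Finset.range (t + 1))]
  · refine Finset.sum_congr rfl fun a ha => ?_
    have ha' : a ≤ t := by simpa [Nat.lt_succ_iff] using ha
    rw [← card_piAntidiag_eq_choose s m a hs, ← card_piAntidiag_eq_choose sᶜ l (2 * t - a) hs',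
      ← card_filter_piAntidiag_sum_eq s (2 * t) a (by omega), Finset.filter_filter]
    congr 1
    refine Finset.filter_congr fun f _ => ?_
    constructor
    · exact fun h => h.2
    · exact fun h => ⟨by omega, h⟩
  · intro f hf
    have := (Finset.mem_filter.1 hf).2
    simpa [Nat.lt_succ_iff] using this

/-- Tuples with sum `2 * t` all of whose blocks, `s` and the points outside `s`, have sum at most
`t`, counted by removing the tuples with one large coordinate outside `s`. -/
theorem card_filter_piAntidiag_block_le {ι : Type*} [Fintype ι] [DecidableEq ι] (s : Finset ι)
    (m l t : ℕ) (hs : s.card = m + 1) (hs' : sᶜ.card = l + 1) :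
    ((Finset.piAntidiag Finset.univ (2 * t)).filter fun f : ι → ℕ =>
        ∑ i ∈ s, f i ≤ t ∧ ∀ i ∉ s, f i ≤ t).card +
      (l + 1) * (t + (m + l)).choose (m + l + 1) =
      ∑ a ∈ Finset.range (t + 1), (a + m).choose m * (2 * t - a + l).choose l := by
  have key : (l + 1) * (t + (m + l)).choose (m + l + 1) =
      (sᶜ.biUnion fun i => (Finset.piAntidiag Finset.univ (2 * t)).filter
        fun f : ι → ℕ => t < f i).card := by
    rw [Finset.card_biUnion]
    · rw [← hs', ← smul_eq_mul, Finset.sum_const_nat, smul_eq_mul]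
      intro i _
      rcases t with _ | q
      · rw [Nat.choose_eq_zero_of_lt (by omega)]
        simp
      · rw [show 2 * (q + 1) = q + 1 + 1 + q by ring, card_filter_piAntidiag_lt,
          card_piAntidiag_eq_choose _ (m + l + 1)]
        · congr 1; omega
        · rw [Finset.card_univ, ← Finset.card_add_card_compl s]; omega
    · intro i _ j _ hij
      rw [Function.onFun, Finset.disjoint_left]
      intro f hf hf'
      simp only [Finset.mem_filter, Finset.mem_piAntidiag] at hf hf'
      have h1 := Finset.sum_le_univ_sum_of_nonneg (s := {i, j}) (f := f) (fun _ => Nat.zero_le _)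
      rw [Finset.sum_pair hij] at h1
      have h2 : ∑ i, f i = 2 * t := hf.1.1
      omega
  rw [key, ← card_filter_piAntidiag_sum_le s m l t hs hs', ← Finset.card_union_of_disjoint]
  · congr 1
    ext f
    simp only [Finset.mem_union, Finset.mem_filter, Finset.mem_biUnion, Finset.mem_compl]
    constructor
    · rintro (h | ⟨i, hi, h, hlt⟩)
      · exact ⟨h.1, h.2.1⟩
      · refine ⟨h, ?_⟩
        have h1 := Finset.sum_add_sum_compl s f
        have h2 := Finset.single_le_sum (f := f) (fun _ _ => Nat.zero_le _)
          (Finset.mem_compl.2 hi)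
        have h3 : ∑ i, f i = 2 * t := (Finset.mem_piAntidiag.1 h).1
        omega
    · rintro ⟨h, hle⟩
      by_cases hc : ∀ i ∉ s, f i ≤ t
      · exact Or.inl ⟨h, hle, hc⟩
      · push Not at hc
        obtain ⟨i, hi, hlt⟩ := hc
        exact Or.inr ⟨i, hi, h, hlt⟩
  · rw [Finset.disjoint_left]
    intro f hf hf'
    simp only [Finset.mem_filter, Finset.mem_biUnion, Finset.mem_compl] at hf hf'
    obtain ⟨i, hi, -, hlt⟩ := hf'
    exact absurd (hf.2.2 i hi) (by omega)

/-- The coordinates below `n - l - 1`, which form a parallel class of `M_n[1,l]`. -/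
def firstBlock (n l : ℕ) : Finset (Fin n) :=
  Finset.univ.filter fun i => i.val < n - l - 1

theorem mem_firstBlock {n l : ℕ} {i : Fin n} : i ∈ firstBlock n l ↔ i.val < n - l - 1 := by
  simp [firstBlock]

theorem mem_MklBases_one {n l : ℕ} (hn : l < n - 2) (B : Finset (Fin n)) :
    B ∈ MklBases n 1 l ↔ B.card = 2 ∧ (B ∩ firstBlock n l).card ≤ 1 := by
  have hmono : ∀ i j, i ≤ j → pathHeight B i ≤ pathHeight B j := fun i j hij =>
    Finset.card_le_card (Finset.monotone_filter_right B fun a _ ha => lt_of_lt_of_le ha hij)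
  have hle : ∀ i, pathHeight B i ≤ B.card := fun i => Finset.card_filter_le _ _
  have hfirst : pathHeight B (n - l - 1) = (B ∩ firstBlock n l).card := by
    unfold pathHeight
    congr 1
    ext i
    simp [mem_firstBlock]
  have hfull : pathHeight B n = B.card := by
    unfold pathHeight
    rw [Finset.filter_true_of_mem fun i _ => i.isLt]
  have hlast : B.card ≤ pathHeight B (n - 1) + 1 := by
    have h1 : B ⊆ insert ⟨n - 1, by omega⟩ (B.filter fun j => j.val < n - 1) := by
      intro i hi
      have := i.isLt
      simp only [Finset.mem_insert, Finset.mem_filter, Fin.ext_iff]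
      by_cases h : i.val = n - 1
      · exact Or.inl h
      · exact Or.inr ⟨hi, by omega⟩
    exact (Finset.card_le_card h1).trans (Finset.card_insert_le _ _)
  have hzero : pathHeight B 0 = 0 := by simp [pathHeight]
  simp only [MklBases, Finset.mem_filter, Finset.mem_univ, true_and, Finset.mem_range, upperHt,
    lowerHt]
  refine and_congr_right fun hB => ⟨fun h => ?_, fun h i hi => ?_⟩
  · have := (h (n - l - 1) (by omega)).2
    rw [if_pos (by omega), if_neg (by omega)] at this
    omega
  · have h1 := hle i
    constructor
    · by_cases hin : n ≤ i
      · have : i = n := by omega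
        subst this
        split_ifs <;> omega
      · by_cases hin' : n - 1 ≤ i
        · have : i = n - 1 := by omega
          subst this
          split_ifs; omega
        · simp [hin, hin']
    · by_cases hi0 : 1 ≤ i
      · by_cases hil : n - l ≤ i
        · simp only [hi0, hil, if_true]; omega
        · have := hmono i (n - l - 1) (by omega)
          simp only [hi0, hil, if_true, if_false]; omega
      · have : i = 0 := by omega
        subst this
        omega

/-- The inequalities defining the dilate by `c` of the polytope of `M_n[1,l]`. -/
def schubertIneq (n l : ℕ) (c : ℝ) (x : Fin n → ℝ) : Prop :=
  ∑ i, x i = 2 * c ∧ ∑ i ∈ firstBlock n l, x i ≤ c ∧ ∀ i, 0 ≤ x i ∧ x i ≤ c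

theorem schubertIneq_of_mem {n l : ℕ} (hn : l < n - 2) {x : Fin n → ℝ}
    (hx : x ∈ MklPolytope n 1 l) : schubertIneq n l 1 x := by
  have hconv : Convex ℝ {x | schubertIneq n l 1 x} := by
    rintro x ⟨hx1, hx2, hx3⟩ y ⟨hy1, hy2, hy3⟩ a b ha hb hab
    refine ⟨?_, ?_, fun i => ?_⟩
    · simp only [Pi.add_apply, Pi.smul_apply, smul_eq_mul, Finset.sum_add_distrib,
        ← Finset.mul_sum, hx1, hy1]
      linear_combination 2 * hab
    · simp only [Pi.add_apply, Pi.smul_apply, smul_eq_mul, Finset.sum_add_distrib,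
        ← Finset.mul_sum]
      nlinarith
    · have := hx3 i
      have := hy3 i
      simp only [Pi.add_apply, Pi.smul_apply, smul_eq_mul]
      constructor <;> nlinarith
  refine convexHull_min ?_ hconv hx
  rintro _ ⟨B, hB, rfl⟩
  obtain ⟨h1, h2⟩ := (mem_MklBases_one hn B).1 hB
  refine ⟨?_, ?_, fun i => ?_⟩
  · simp [indVec, h1]
  · have : ∑ i ∈ firstBlock n l, indVec B i = ((B ∩ firstBlock n l).card : ℝ) := by
      simp [indVec, Finset.inter_comm]
    rw [this]
    exact_mod_cast h2
  · unfold indVec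
    split_ifs <;> norm_num

/-- If a weight of total mass `2 * (t + 1)` has mass at most `t + 1` on every block, then two points
of the support in different blocks meet every block of mass `t + 1`. -/
theorem exists_pair_of_block_sum_le {ι κ : Type*} [Fintype ι] [Fintype κ] [DecidableEq κ]
    (blk : ι → κ) (f : ι → ℕ) (t : ℕ) (hf : ∑ i, f i = 2 * (t + 1))
    (hblk : ∀ b, ∑ i with blk i = b, f i ≤ t + 1) :
    ∃ i j, blk i ≠ blk j ∧ 0 < f i ∧ 0 < f j ∧
      ∀ b, b ≠ blk i → b ≠ blk j → ∑ i with blk i = b, f i ≤ t := by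
  set y : κ → ℕ := fun b => ∑ i with blk i = b, f i with hy
  have hsum : ∑ b, y b = 2 * (t + 1) := by
    rw [← hf]
    exact Finset.sum_fiberwise _ _ _
  have hpos : ∀ b, 0 < y b → ∃ i, blk i = b ∧ 0 < f i := by
    intro b hb
    obtain ⟨i, hi, hfi⟩ := Finset.exists_ne_zero_of_sum_ne_zero hb.ne'
    exact ⟨i, by simpa using hi, Nat.pos_of_ne_zero hfi⟩
  have hne : (Finset.univ : Finset κ).Nonempty := by
    rw [Finset.nonempty_iff_ne_empty]
    intro h
    rw [h] at hsum
    simp at hsum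
  obtain ⟨b₁, -, hb₁⟩ := Finset.exists_max_image Finset.univ y hne
  have hrest : y b₁ + ∑ b ∈ Finset.univ.erase b₁, y b = 2 * (t + 1) := by
    rw [Finset.add_sum_erase _ _ (Finset.mem_univ _), hsum]
  have hb₁le : y b₁ ≤ t + 1 := hblk b₁
  obtain ⟨c, hc, hyc⟩ := Finset.exists_ne_zero_of_sum_ne_zero
    (show ∑ b ∈ Finset.univ.erase b₁, y b ≠ 0 by omega)
  obtain ⟨b₂, hb₂mem, hb₂⟩ := Finset.exists_max_image (Finset.univ.erase b₁) y ⟨c, hc⟩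
  have h1 := hb₁ c (Finset.mem_univ _)
  have h2 := hb₂ c hc
  obtain ⟨i, hi, hfi⟩ := hpos b₁ (by omega)
  obtain ⟨j, hj, hfj⟩ := hpos b₂ (by omega)
  have hne : b₂ ≠ b₁ := Finset.ne_of_mem_erase hb₂mem
  refine ⟨i, j, by rw [hi, hj]; exact hne.symm, hfi, hfj, fun b hbi hbj => ?_⟩
  rw [hi] at hbi
  rw [hj] at hbj
  have h3 := hb₁ b (Finset.mem_univ _)
  have h4 := hb₂ b (by simp [hbi])
  have h5 := Finset.add_sum_erase (Finset.univ.erase b₁) y hb₂mem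
  have h6 := Finset.single_le_sum (f := y) (fun _ _ => Nat.zero_le _)
    (show b ∈ (Finset.univ.erase b₁).erase b₂ by simp [hbi, hbj])
  change y b ≤ t
  omega

theorem indVec_mem_MklPolytope {n l : ℕ} (hn : l < n - 2) {i j : Fin n} (hij : i ≠ j)
    (h : i ∉ firstBlock n l ∨ j ∉ firstBlock n l) : indVec {i, j} ∈ MklPolytope n 1 l := by
  refine subset_convexHull _ _ ⟨{i, j}, (mem_MklBases_one hn _).2 ⟨Finset.card_pair hij, ?_⟩, rfl⟩
  rcases h with h | h
  · refine (Finset.card_le_card (t := {j}) ?_).trans (by simp)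
    intro k hk
    simp only [Finset.mem_inter, Finset.mem_insert, Finset.mem_singleton] at hk ⊢
    rcases hk.1 with rfl | rfl
    · exact absurd hk.2 h
    · rfl
  · refine (Finset.card_le_card (t := {i}) ?_).trans (by simp)
    intro k hk
    simp only [Finset.mem_inter, Finset.mem_insert, Finset.mem_singleton] at hk ⊢
    rcases hk.1 with rfl | rfl
    · rfl
    · exact absurd hk.2 h

/-- A lattice point satisfying the inequalities of the `t`-th dilate is in the dilate. -/
theorem natCast_mem_smul_MklPolytope {n l : ℕ} (hn : l < n - 2) (t : ℕ) (f : Fin n → ℕ)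
    (h1 : ∑ i, f i = 2 * t) (h2 : ∑ i ∈ firstBlock n l, f i ≤ t)
    (h3 : ∀ i ∉ firstBlock n l, f i ≤ t) :
    (fun i => (f i : ℝ)) ∈ (t : ℝ) • MklPolytope n 1 l := by
  induction t generalizing f with
  | zero =>
    have hf : (fun i => (f i : ℝ)) = 0 := by
      funext i
      have : ∀ i, f i = 0 := by simpa using h1
      simp [this i]
    rw [hf, Nat.cast_zero, Set.zero_smul_set]
    · rfl
    · exact ⟨_, indVec_mem_MklPolytope hn (i := ⟨n - 1, by omega⟩) (j := ⟨n - 2, by omega⟩)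
        (by simp [Fin.ext_iff]; omega) (Or.inl (by rw [mem_firstBlock]; simp; omega))⟩
  | succ t ih =>
    let blk : Fin n → Option (Fin n) := fun i => if i ∈ firstBlock n l then none else some i
    have hnone : ∀ g : Fin n → ℕ, ∑ i with blk i = none, g i = ∑ i ∈ firstBlock n l, g i := by
      intro g
      congr 1
      ext i
      simp [blk]
    have hsome : ∀ (g : Fin n → ℕ) (i), i ∉ firstBlock n l → ∑ j with blk j = some i, g j = g i := by
      intro g i hi
      rw [Finset.sum_eq_single_of_mem i]
      · simp [blk, hi]
      · intro j hj hji
        simp only [Finset.mem_filter, Finset.mem_univ, true_and, blk] at hj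
        split_ifs at hj
        exact absurd (Option.some.inj hj) hji
    obtain ⟨i, j, hij, hi, hj, hrest⟩ := exists_pair_of_block_sum_le blk f t h1 (by
      rintro (_ | i)
      · rw [hnone]; exact h2
      · by_cases hi : i ∈ firstBlock n l
        · rw [Finset.sum_eq_zero]
          · omega
          · intro j hj
            simp only [Finset.mem_filter, Finset.mem_univ, true_and, blk] at hj
            split_ifs at hj with hj'
            rw [Option.some.inj hj] at hj'
            exact absurd hi hj'
        · rw [hsome f i hi]; exact h3 i hi)
    have hne : i ≠ j := fun h => hij (by rw [h])
    have hblock : i ∉ firstBlock n l ∨ j ∉ firstBlock n l := by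
      by_contra! h
      exact hij (by simp [blk, h.1, h.2])
    let e : Fin n → ℕ := fun k => if k ∈ ({i, j} : Finset (Fin n)) then 1 else 0
    obtain ⟨g, hg⟩ : ∃ g : Fin n → ℕ, ∀ k, f k = g k + e k := by
      refine ⟨fun k => f k - e k, fun k => (Nat.sub_add_cancel ?_).symm⟩
      simp only [e, Finset.mem_insert, Finset.mem_singleton]
      split_ifs with hk
      · rcases hk with rfl | rfl <;> assumption
      · exact Nat.zero_le _
    have hblksum : ∀ b, ∑ k with blk k = b, f k ≤ t + 1 →
        ∑ k with blk k = b, g k ≤ t := by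
      intro b hb
      by_cases hbi : b = blk i
      · have h4 : ∑ k with blk k = b, g k < ∑ k with blk k = b, f k := by
          refine Finset.sum_lt_sum (fun k _ => by have := hg k; omega) ⟨i, by simp [hbi], ?_⟩
          have := hg i
          simp only [e, Finset.mem_insert, true_or, if_true] at this
          omega
        omega
      · by_cases hbj : b = blk j
        · have h4 : ∑ k with blk k = b, g k < ∑ k with blk k = b, f k := by
            refine Finset.sum_lt_sum (fun k _ => by have := hg k; omega) ⟨j, by simp [hbj], ?_⟩
            have := hg j
            simp only [e, Finset.mem_insert, Finset.mem_singleton, or_true, if_true] at this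
            omega
          omega
        · exact (Finset.sum_le_sum fun k _ => by have := hg k; omega).trans (hrest b hbi hbj)
    have hmem := ih g (by
        have h4 : ∑ k, f k = ∑ k, g k + ∑ k, e k := by
          rw [← Finset.sum_add_distrib]
          exact Finset.sum_congr rfl fun k _ => hg k
        have h5 : ∑ k, e k = 2 := by
          simp only [e, Finset.sum_ite_mem, Finset.univ_inter]
          simp [Finset.card_pair hne]
        omega)
      (by rw [← hnone]; exact hblksum none (by rw [hnone]; exact h2))
      (fun k hk => by
        rw [← hsome g k hk]
        exact hblksum (some k) (by rw [hsome f k hk]; exact h3 k hk))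
    have hadd := (convex_convexHull ℝ {x | ∃ B ∈ MklBases n 1 l, x = indVec B}).add_smul
      (Nat.cast_nonneg t) (zero_le_one' ℝ)
    rw [one_smul] at hadd
    push_cast
    change _ ∈ ((t : ℝ) + 1) • convexHull ℝ _
    rw [hadd]
    refine ⟨_, hmem, _, indVec_mem_MklPolytope hn hne hblock, ?_⟩
    funext k
    simp only [Pi.add_apply, hg k, indVec, e]
    push_cast
    rfl

/-- The lattice points of the `t`-th dilate of the polytope of `M_n[1,l]`, counted as tuples of
natural numbers. -/
theorem latticeCount_smul_MklPolytope {n l : ℕ} (hn : l < n - 2) (t : ℕ) :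
    latticeCount ((t : ℝ) • MklPolytope n 1 l) =
      ((Finset.piAntidiag Finset.univ (2 * t)).filter fun f : Fin n → ℕ =>
        ∑ i ∈ firstBlock n l, f i ≤ t ∧ ∀ i ∉ firstBlock n l, f i ≤ t).card := by
  have hinj : Function.Injective fun (f : Fin n → ℕ) (i : Fin n) => (f i : ℝ) := by
    intro f g hfg
    funext i
    have : (f i : ℝ) = g i := congrFun hfg i
    exact_mod_cast this
  rw [latticeCount, ← Set.ncard_coe_finset, ← Set.ncard_image_of_injective _ hinj]
  congr 1
  ext x
  simp only [Set.mem_sep_iff, Set.mem_image, Finset.mem_coe, Finset.mem_filter,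
    Finset.mem_piAntidiag]
  constructor
  · rintro ⟨⟨y, hy, rfl⟩, hint⟩
    obtain ⟨hy1, hy2, hy3⟩ := schubertIneq_of_mem hn hy
    have ht : (0 : ℝ) ≤ t := Nat.cast_nonneg t
    choose z hz using hint
    have hz0 : ∀ i, 0 ≤ z i := by
      intro i
      have h1 := hz i
      simp only [Pi.smul_apply, smul_eq_mul] at h1
      have : (0 : ℝ) ≤ z i := by rw [← h1]; exact mul_nonneg ht (hy3 i).1
      exact_mod_cast this
    lift z to Fin n → ℕ using hz0
    have hz' : ∀ i, (z i : ℝ) = t * y i := fun i => by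
      have := hz i
      simp only [Pi.smul_apply, smul_eq_mul, Int.cast_natCast] at this
      exact this.symm
    refine ⟨z, ⟨⟨?_, by simp⟩, ?_, fun i _ => ?_⟩, ?_⟩
    · have : ((∑ i, z i : ℕ) : ℝ) = 2 * t := by
        push_cast
        simp only [hz', ← Finset.mul_sum, hy1]
        ring
      exact_mod_cast this
    · have : ((∑ i ∈ firstBlock n l, z i : ℕ) : ℝ) ≤ t := by
        push_cast
        simp only [hz', ← Finset.mul_sum]
        exact mul_le_of_le_one_right ht hy2
      exact_mod_cast this
    · have : (z i : ℝ) ≤ t := by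
        rw [hz']
        exact mul_le_of_le_one_right ht (hy3 i).2
      exact_mod_cast this
    · funext i
      simp [hz']
  · rintro ⟨f, ⟨⟨h1, -⟩, h2, h3⟩, rfl⟩
    exact ⟨natCast_mem_smul_MklPolytope hn t f h1 h2 h3, fun i => ⟨f i, by simp⟩⟩

/-- The number of maximal runs of consecutive integers in a finite set. -/
def runCount (S : Finset ℕ) : ℕ :=
  (S.filter fun x => x + 1 ∉ S).card

theorem runCount_insert_of_not_adjacent {T : Finset ℕ} {d : ℕ} (hT : ∀ x ∈ T, x < d) :
    runCount (insert (d + 1) T) = runCount T + 1 := by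
  unfold runCount
  rw [Finset.filter_insert, if_pos, Finset.card_insert_of_notMem]
  · congr 2
    refine Finset.filter_congr fun x hx => ?_
    have := hT x hx
    simp only [Finset.mem_insert, not_or]
    exact ⟨fun h => h.2, fun h => ⟨by omega, h⟩⟩
  · intro h
    have := hT _ (Finset.mem_filter.1 h).1
    omega
  · simp only [Finset.mem_insert, not_or]
    exact ⟨by omega, fun h => by have := hT _ h; omega⟩

theorem runCount_insert_insert {T : Finset ℕ} {d : ℕ} (hT : ∀ x ∈ T, x < d) :
    runCount (insert (d + 1) (insert d T)) = runCount (insert d T) := by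
  have h : ∀ y, d ≤ y → y ∉ T := fun y hy h => by have := hT _ h; omega
  unfold runCount
  rw [Finset.filter_insert, Finset.filter_insert, Finset.filter_insert, if_pos, if_neg, if_pos,
    Finset.card_insert_of_notMem, Finset.card_insert_of_notMem]
  · congr 2
    refine Finset.filter_congr fun x hx => ?_
    have := hT x hx
    simp only [Finset.mem_insert, not_or]
    exact ⟨fun h => h.2, fun h => ⟨by omega, h⟩⟩
  · simp [h d le_rfl]
  · simp [h (d + 1) (by omega)]
  · simp [h (d + 1) (by omega)]
  · simp
  · simp [h (d + 1 + 1) (by omega)]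
    omega

theorem card_filter_powersetCard_succ (d i : ℕ) (p : Finset ℕ → Prop) [DecidablePred p] :
    ((Finset.powersetCard (i + 1) (Finset.range (d + 1))).filter p).card =
      ((Finset.powersetCard (i + 1) (Finset.range d)).filter p).card +
        ((Finset.powersetCard i (Finset.range d)).filter fun T => p (insert d T)).card := by
  have hd : ∀ {j : ℕ} {T : Finset ℕ}, T ∈ Finset.powersetCard j (Finset.range d) → d ∉ T :=
    fun hT h => by simpa using (Finset.mem_powersetCard.1 hT).1 h
  rw [Finset.range_add_one, Finset.powersetCard_succ_insert (by simp), Finset.filter_union,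
    Finset.card_union_of_disjoint]
  · congr 1
    rw [Finset.filter_image, Finset.card_image_of_injOn]
    intro T hT U hU hTU
    have hT' := hd (Finset.mem_filter.1 hT).1
    have hU' := hd (Finset.mem_filter.1 hU).1
    rw [← Finset.erase_insert hT', ← Finset.erase_insert hU']
    exact congrArg (fun V => Finset.erase V d) hTU
  · rw [Finset.disjoint_left]
    intro T hT hT'
    obtain ⟨U, -, rfl⟩ := Finset.mem_image.1 (Finset.mem_filter.1 hT').1
    exact hd (Finset.mem_filter.1 hT).1 (Finset.mem_insert_self _ _)

theorem runCount_pos {S : Finset ℕ} (hS : S.Nonempty) : 0 < runCount S := by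
  refine Finset.card_pos.2 ⟨S.max' hS, Finset.mem_filter.2 ⟨S.max'_mem hS, fun h => ?_⟩⟩
  have := S.le_max' _ h
  omega

theorem card_runCount_eq_aux (d : ℕ) :
    (∀ i k, ((Finset.powersetCard (i + 1) (Finset.range d)).filter
      fun S => runCount S = k + 1).card = i.choose k * (d - i).choose (k + 1)) ∧
    ∀ i k, i ≤ d → ((Finset.powersetCard i (Finset.range d)).filter
      fun S => runCount (insert d S) = k + 1).card = i.choose k * (d - i).choose k := by
  have hzero : ∀ d k, ((Finset.powersetCard 0 (Finset.range d)).filter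
      fun S => runCount (insert d S) = k + 1).card = Nat.choose 0 k * d.choose k := by
    intro d k
    rw [Finset.powersetCard_zero, Finset.filter_singleton]
    have : runCount (insert d ∅) = 1 := by simp [runCount, Finset.filter_singleton]
    rw [this]
    rcases k with _ | k
    · simp
    · simp
  induction d with
  | zero =>
    refine ⟨fun i k => by simp, fun i k hi => ?_⟩
    obtain rfl : i = 0 := by omega
    exact hzero 0 k
  | succ d ih =>
    obtain ⟨ih1, ih2⟩ := ih
    refine ⟨fun i k => ?_, fun i k hi => ?_⟩
    · rw [card_filter_powersetCard_succ, ih1]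
      by_cases hi : i ≤ d
      · rw [ih2 i k hi, Nat.succ_sub hi, Nat.succ_eq_add_one, Nat.choose_succ_succ']
        ring
      · rw [Finset.powersetCard_eq_empty.2 (by simp; omega)]
        simp [show d - i = 0 by omega, show d + 1 - i = 0 by omega]
    · rcases i with _ | i
      · exact hzero _ k
      rw [card_filter_powersetCard_succ]
      have e1 : ((Finset.powersetCard i (Finset.range d)).filter
          fun T => runCount (insert (d + 1) (insert d T)) = k + 1).card =
          i.choose k * (d - i).choose k := by
        rw [← ih2 i k (by omega)]
        congr 1
        refine Finset.filter_congr fun T hT => ?_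
        rw [runCount_insert_insert fun x hx => by
          simpa using (Finset.mem_powersetCard.1 hT).1 hx]
      have e2 : ((Finset.powersetCard (i + 1) (Finset.range d)).filter
          fun T => runCount (insert (d + 1) T) = k + 1) =
          (Finset.powersetCard (i + 1) (Finset.range d)).filter fun T => runCount T = k := by
        refine Finset.filter_congr fun T hT => ?_
        rw [runCount_insert_of_not_adjacent fun x hx => by
          simpa using (Finset.mem_powersetCard.1 hT).1 hx]
        omega
      rw [e1, e2, Nat.add_sub_add_right]
      rcases k with _ | k
      · rw [Finset.filter_false_of_mem]
        · simp
        · intro T hT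
          have : T.Nonempty := Finset.card_pos.1 (by
            rw [(Finset.mem_powersetCard.1 hT).2]; omega)
          exact (runCount_pos this).ne'
      · rw [ih1, Nat.choose_succ_succ' i k]
        ring

/-- The number of subsets of `{0, …, d - 1}` with `i + 1` elements and `k + 1` runs. -/
theorem card_runCount_eq (d i k : ℕ) :
    ((Finset.powersetCard (i + 1) (Finset.range d)).filter
      fun S => runCount S = k + 1).card = i.choose k * (d - i).choose (k + 1) :=
  (card_runCount_eq_aux d).1 i k

/-- The one-line notation of `π` ascends everywhere except possibly from the `j`-th to the
`(j + 1)`-st entry. -/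
def AscendsOff {m : ℕ} (π : Equiv.Perm (Fin m)) (j : ℕ) : Prop :=
  ∀ p, p + 1 < m → p + 1 ≠ j → oneLine π p < oneLine π (p + 1)

/-- The number of gaps among the first `i + 1` entries of `π`. -/
def gapCount {m : ℕ} (π : Equiv.Perm (Fin m)) (i : ℕ) : ℕ :=
  ((Finset.range i).filter fun p => oneLine π (p + 1) ≠ oneLine π p + 1).card

/-- The set of the first `j` entries of `π`. -/
def firstValues {m : ℕ} (π : Equiv.Perm (Fin m)) (j : ℕ) : Finset ℕ :=
  (Finset.range j).image (oneLine π)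

section OneLine

variable {m : ℕ} {π σ : Equiv.Perm (Fin m)} {i j p q : ℕ}

theorem oneLine_of_lt (hp : p < m) : oneLine π p = π ⟨p, hp⟩ := dif_pos hp

theorem oneLine_lt (hp : p < m) : oneLine π p < m := by
  rw [oneLine_of_lt hp]
  exact Fin.isLt _

theorem oneLine_inj (hp : p < m) (hq : q < m) : oneLine π p = oneLine π q ↔ p = q := by
  rw [oneLine_of_lt hp, oneLine_of_lt hq, Fin.val_inj, π.injective.eq_iff, Fin.mk.injEq]

theorem ext_oneLine (h : ∀ p < m, oneLine π p = oneLine σ p) : π = σ := by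
  ext x
  have := h x x.isLt
  rwa [oneLine_of_lt x.isLt, oneLine_of_lt x.isLt] at this

theorem AscendsOff.lt_of_lt (h : AscendsOff π j) (hpq : p < q) (hq : q < m)
    (hj : q < j ∨ j ≤ p) : oneLine π p < oneLine π q := by
  induction q, hpq using Nat.le_induction with
  | base => exact h p hq (by omega)
  | succ q hpq ih =>
    exact (ih (by omega) (by omega)).trans (h q hq (by omega))

theorem firstValues_mem_powersetCard (hj : j ≤ m) :
    firstValues π j ∈ Finset.powersetCard j (Finset.range m) := by
  refine Finset.mem_powersetCard.2 ⟨fun x hx => ?_, ?_⟩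
  · obtain ⟨p, hp, rfl⟩ := Finset.mem_image.1 hx
    have := Finset.mem_range.1 hp
    exact Finset.mem_range.2 (oneLine_lt (by omega))
  · rw [firstValues, Finset.card_image_of_injOn, Finset.card_range]
    intro p hp q hq hpq
    have hp' : p < j := by simpa using hp
    have hq' : q < j := by simpa using hq
    exact (oneLine_inj (by omega) (by omega)).1 hpq

theorem oneLine_mem_firstValues (hj : j ≤ m) (hp : p < m) :
    oneLine π p ∈ firstValues π j ↔ p < j := by
  constructor
  · intro h
    obtain ⟨q, hq, hpq⟩ := Finset.mem_image.1 h
    have hq' := Finset.mem_range.1 hq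
    rwa [(oneLine_inj (by omega) hp).1 hpq] at hq'
  · exact fun h => Finset.mem_image_of_mem _ (Finset.mem_range.2 h)

theorem AscendsOff.eq_of_firstValues_eq (hπ : AscendsOff π j) (hσ : AscendsOff σ j) (hj : j ≤ m)
    (h : firstValues π j = firstValues σ j) : π = σ := by
  have hcard := (Finset.mem_powersetCard.1 (firstValues_mem_powersetCard (π := π) hj)).2
  have hsub := (Finset.mem_powersetCard.1 (firstValues_mem_powersetCard (π := π) hj)).1
  have hcard' : (Finset.range m \ firstValues π j).card = m - j := by
    rw [Finset.card_sdiff_of_subset hsub, hcard, Finset.card_range]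
  have hfirst : ∀ {τ : Equiv.Perm (Fin m)}, AscendsOff τ j → firstValues π j = firstValues τ j →
      (fun x : Fin j => oneLine τ x) = (firstValues π j).orderEmbOfFin hcard := by
    intro τ hτ hπτ
    refine Finset.orderEmbOfFin_unique hcard (fun x => ?_) fun x y hxy => ?_
    · rw [hπτ, oneLine_mem_firstValues hj (by omega)]
      exact x.isLt
    · exact hτ.lt_of_lt hxy (by omega) (Or.inl y.isLt)
  have hlast : ∀ {τ : Equiv.Perm (Fin m)}, AscendsOff τ j → firstValues π j = firstValues τ j →
      (fun x : Fin (m - j) => oneLine τ (j + x)) =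
        (Finset.range m \ firstValues π j).orderEmbOfFin hcard' := by
    intro τ hτ hπτ
    refine Finset.orderEmbOfFin_unique hcard' (fun x => ?_) fun x y hxy => ?_
    · rw [hπτ, Finset.mem_sdiff, oneLine_mem_firstValues hj (by omega), Finset.mem_range]
      exact ⟨oneLine_lt (by omega), by omega⟩
    · have : x.val < y.val := hxy
      exact hτ.lt_of_lt (by omega) (by omega) (Or.inr (by omega))
  refine ext_oneLine fun p hp => ?_
  by_cases hpj : p < j
  · exact congrFun ((hfirst hπ rfl).trans (hfirst hσ h).symm) ⟨p, hpj⟩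
  · have := congrFun ((hlast hπ rfl).trans (hlast hσ h).symm) ⟨p - j, by omega⟩
    simpa [Nat.add_sub_cancel' (not_lt.1 hpj)] using this

theorem exists_ascendsOff_firstValues_eq {S : Finset ℕ} (hj : j ≤ m)
    (hS : S ∈ Finset.powersetCard j (Finset.range m)) :
    ∃ π : Equiv.Perm (Fin m), AscendsOff π j ∧ firstValues π j = S := by
  obtain ⟨hsub, hcard⟩ := Finset.mem_powersetCard.1 hS
  have hlt : ∀ x ∈ S, x < m := fun x hx => Finset.mem_range.1 (hsub hx)
  set T : Finset (Fin m) := S.attachFin hlt with hT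
  have hTc : T.card = j := by rw [hT, Finset.card_attachFin, hcard]
  have hTc' : Tᶜ.card = m - j := by rw [Finset.card_compl, hTc, Fintype.card_fin]
  let π : Equiv.Perm (Fin m) :=
    ((finCongr (show m = j + (m - j) by omega)).trans finSumFinEquiv.symm).trans
      (finSumEquivOfFinset hTc hTc')
  have hfirst : ∀ p (hp : p < j), oneLine π p = T.orderEmbOfFin hTc ⟨p, hp⟩ := by
    intro p hp
    rw [oneLine_of_lt (by omega), ← finSumEquivOfFinset_inl hTc hTc']
    have : finSumFinEquiv.symm (Fin.castAdd (m - j) ⟨p, hp⟩) = Sum.inl ⟨p, hp⟩ :=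
      finSumFinEquiv_symm_apply_castAdd _
    rw [← this]
    rfl
  have hlast : ∀ p (hp : p < m) (hpj : j ≤ p),
      oneLine π p = Tᶜ.orderEmbOfFin hTc' ⟨p - j, by omega⟩ := by
    intro p hp hpj
    rw [oneLine_of_lt hp, ← finSumEquivOfFinset_inr hTc hTc']
    have : finSumFinEquiv.symm (Fin.natAdd j (⟨p - j, by omega⟩ : Fin (m - j))) =
        Sum.inr ⟨p - j, by omega⟩ := finSumFinEquiv_symm_apply_natAdd _
    rw [← this]
    have e : (finCongr (show m = j + (m - j) by omega)) ⟨p, hp⟩ =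
        Fin.natAdd j (⟨p - j, by omega⟩ : Fin (m - j)) := by
      simp [Nat.add_sub_cancel' hpj]
    rw [← e]
    rfl
  refine ⟨π, fun p hp hpj => ?_, ?_⟩
  · by_cases h : p + 1 < j
    · rw [hfirst p (by omega), hfirst (p + 1) h]
      exact (T.orderEmbOfFin hTc).strictMono (Fin.mk_lt_mk.2 (Nat.lt_succ_self p))
    · rw [hlast p (by omega) (by omega), hlast (p + 1) hp (by omega)]
      exact (Tᶜ.orderEmbOfFin hTc').strictMono (Fin.mk_lt_mk.2 (by omega))
  · refine Finset.eq_of_subset_of_card_le (fun x hx => ?_) ?_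
    · obtain ⟨p, hp, rfl⟩ := Finset.mem_image.1 hx
      rw [hfirst p (Finset.mem_range.1 hp)]
      exact (Finset.mem_attachFin hlt).1 (T.orderEmbOfFin_mem hTc _)
    · rw [hcard, (Finset.mem_powersetCard.1 (firstValues_mem_powersetCard hj)).2]

theorem AscendsOff.runCount_firstValues (h : AscendsOff π (i + 1)) (hi : i < m) :
    runCount (firstValues π (i + 1)) = gapCount π i + 1 := by
  have hmem : ∀ p ≤ i, (oneLine π p + 1 ∈ firstValues π (i + 1) ↔
      p < i ∧ oneLine π (p + 1) = oneLine π p + 1) := by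
    intro p hp
    constructor
    · intro hx
      obtain ⟨q, hq, hpq⟩ := Finset.mem_image.1 hx
      have hq' := Finset.mem_range.1 hq
      have hlt : p < q := by
        by_contra! hle
        rcases hle.lt_or_eq with hlt | rfl
        · have := h.lt_of_lt hlt (by omega) (Or.inl (by omega))
          omega
        · omega
      refine ⟨by omega, ?_⟩
      have h1 := h.lt_of_lt (Nat.lt_succ_self p) (by omega) (Or.inl (by omega))
      rcases (Nat.succ_le_of_lt hlt).lt_or_eq with h2 | rfl
      · have := h.lt_of_lt h2 (by omega) (Or.inl (by omega))
        omega
      · exact hpq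
    · rintro ⟨hpi, hp1⟩
      rw [← hp1, oneLine_mem_firstValues (by omega) (by omega)]
      omega
  have hinj : Set.InjOn (oneLine π) (Finset.range (i + 1)) := by
    intro p hp q hq hpq
    have hp' : p < i + 1 := by simpa using hp
    have hq' : q < i + 1 := by simpa using hq
    exact (oneLine_inj (by omega) (by omega)).1 hpq
  rw [runCount]
  conv_lhs => enter [1, 2]; rw [firstValues]
  rw [Finset.filter_image, Finset.card_image_of_injOn
    (hinj.mono (Finset.coe_subset.2 (Finset.filter_subset _ _))), Finset.range_add_one,
    Finset.filter_insert, if_pos (by rw [hmem i le_rfl]; omega),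
    Finset.card_insert_of_notMem (by simp), gapCount]
  congr 2
  refine Finset.filter_congr fun p hp => ?_
  have hp' := Finset.mem_range.1 hp
  rw [hmem p hp'.le]
  tauto

theorem card_ascendsOff (hi : i < m) (g : ℕ) :
    (Finset.univ.filter fun π : Equiv.Perm (Fin m) =>
      AscendsOff π (i + 1) ∧ gapCount π i = g).card = i.choose g * (m - i).choose (g + 1) := by
  rw [← card_runCount_eq]
  refine Finset.card_bij (fun π _ => firstValues π (i + 1)) (fun π hπ => ?_)
    (fun π hπ σ hσ h => ?_) fun S hS => ?_
  · obtain ⟨h1, h2⟩ := (Finset.mem_filter.1 hπ).2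
    refine Finset.mem_filter.2 ⟨firstValues_mem_powersetCard hi, ?_⟩
    rw [h1.runCount_firstValues hi, h2]
  · exact (Finset.mem_filter.1 hπ).2.1.eq_of_firstValues_eq (Finset.mem_filter.1 hσ).2.1 hi h
  · obtain ⟨hS1, hS2⟩ := Finset.mem_filter.1 hS
    obtain ⟨π, hπ, rfl⟩ := exists_ascendsOff_firstValues_eq hi hS1
    refine ⟨π, Finset.mem_filter.2 ⟨Finset.mem_univ _, hπ, ?_⟩, rfl⟩
    rw [hπ.runCount_firstValues hi] at hS2
    omega

theorem oneLine_one (hp : p < m) : oneLine (1 : Equiv.Perm (Fin m)) p = p := by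
  rw [oneLine_of_lt hp, Equiv.Perm.one_apply]

theorem ascendsOff_one (j : ℕ) : AscendsOff (1 : Equiv.Perm (Fin m)) j := by
  intro p hp _
  rw [oneLine_one hp, oneLine_one (by omega)]
  omega

theorem gapCount_one (hi : i < m) : gapCount (1 : Equiv.Perm (Fin m)) i = 0 := by
  refine Finset.card_eq_zero.2 (Finset.filter_false_of_mem fun p hp => ?_)
  have := Finset.mem_range.1 hp
  rw [oneLine_one (by omega), oneLine_one (by omega)]
  omega

theorem AscendsOff.descentAt_of_ne_one (h : AscendsOff π (i + 1)) (hi : i + 1 < m) (hπ : π ≠ 1) :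
    DescentAt π i := by
  by_contra hd
  apply hπ
  have hle : oneLine π i < oneLine π (i + 1) := by
    have h1 : ¬ oneLine π (i + 1) < oneLine π i := fun h => hd ⟨hi, h⟩
    have h2 := (oneLine_inj (π := π) (p := i) (q := i + 1) (by omega) hi).not.2 (by omega)
    omega
  have hoff : AscendsOff π 0 := by
    intro p hp _
    by_cases hpi : p = i
    · exact hpi ▸ hle
    · exact h p hp (by omega)
  exact hoff.eq_of_firstValues_eq (ascendsOff_one 0) (Nat.zero_le _) rfl

theorem descentCount_eq_one_and_descentAt_iff (hi : i + 1 < m) :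
    descentCount π = 1 ∧ DescentAt π i ↔ AscendsOff π (i + 1) ∧ π ≠ 1 := by
  constructor
  · rintro ⟨h1, hd⟩
    refine ⟨fun p hp hpi => ?_, ?_⟩
    · obtain ⟨a, ha⟩ := Finset.card_eq_one.1 h1
      have hia : i ∈ ({a} : Finset ℕ) := ha ▸ Finset.mem_filter.2 ⟨Finset.mem_range.2 (by omega), hd⟩
      have hp1 : ¬ oneLine π (p + 1) < oneLine π p := by
        intro hlt
        have hpa : p ∈ ({a} : Finset ℕ) :=
          ha ▸ Finset.mem_filter.2 ⟨Finset.mem_range.2 (by omega), hp, hlt⟩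
        rw [Finset.mem_singleton] at hia hpa
        omega
      have h2 := (oneLine_inj (π := π) (p := p) (q := p + 1) (by omega) hp).not.2 (by omega)
      omega
    · rintro rfl
      have := hd.2
      rw [oneLine_one hi, oneLine_one (by omega)] at this
      omega
  · rintro ⟨h, hπ⟩
    have hd := h.descentAt_of_ne_one hi hπ
    refine ⟨Finset.card_eq_one.2 ⟨i, ?_⟩, hd⟩
    ext p
    rw [Finset.mem_filter, Finset.mem_singleton]
    constructor
    · rintro ⟨-, hp, hlt⟩
      by_contra hpi
      have := h p hp (by omega)
      omega
    · rintro rfl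
      exact ⟨Finset.mem_range.2 (by omega), hd⟩

theorem AscendsOff.eq_of_descentAt (h : AscendsOff π (i + 1)) (hp : DescentAt π p) : p = i := by
  by_contra hpi
  have := h p hp.1 (by omega)
  have := hp.2
  omega

theorem AscendsOff.initialGaps_eq (h : AscendsOff π (i + 1)) (hd : DescentAt π i) :
    initialGaps π = gapCount π i := by
  have hi := hd.1
  unfold initialGaps gapCount
  congr 1
  ext p
  simp only [Finset.mem_filter, Finset.mem_range]
  constructor
  · rintro ⟨-, ⟨q, -, hq, hpq⟩, hne⟩
    obtain rfl := h.eq_of_descentAt hq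
    exact ⟨hpq, hne⟩
  · rintro ⟨hp, hne⟩
    exact ⟨by omega, ⟨i, by omega, hd, hp⟩, hne⟩

end OneLine

theorem card_one_descent_at (m i g : ℕ) (hi : i + 1 < m) :
    (Finset.univ.filter fun π : Equiv.Perm (Fin m) =>
        (descentCount π = 1 ∧ DescentAt π i) ∧ initialGaps π = g).card +
      (if g = 0 then 1 else 0) = i.choose g * (m - i).choose (g + 1) := by
  rw [← card_ascendsOff (by omega : i < m) g]
  have heq : (Finset.univ.filter fun π : Equiv.Perm (Fin m) =>
      (descentCount π = 1 ∧ DescentAt π i) ∧ initialGaps π = g) =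
      (Finset.univ.filter fun π : Equiv.Perm (Fin m) =>
        AscendsOff π (i + 1) ∧ gapCount π i = g).erase 1 := by
    ext π
    simp only [Finset.mem_filter, Finset.mem_univ, true_and, Finset.mem_erase]
    rw [descentCount_eq_one_and_descentAt_iff hi]
    constructor
    · rintro ⟨⟨h, hπ⟩, hg⟩
      rw [h.initialGaps_eq (h.descentAt_of_ne_one hi hπ)] at hg
      exact ⟨hπ, h, hg⟩
    · rintro ⟨hπ, h, hg⟩
      rw [← h.initialGaps_eq (h.descentAt_of_ne_one hi hπ)] at hg
      exact ⟨⟨h, hπ⟩, hg⟩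
  rw [heq]
  split_ifs with hg
  · exact Finset.card_erase_add_one (Finset.mem_filter.2
      ⟨Finset.mem_univ _, ascendsOff_one _, (gapCount_one (by omega)).trans hg.symm⟩)
  · rw [Finset.erase_eq_of_notMem, add_zero]
    intro h
    exact hg ((Finset.mem_filter.1 h).2.2.symm.trans (gapCount_one (by omega)))

/-- The number of permutations of `[m]` with a single descent, in position at most `l`, and with
`g` initial gaps. -/
theorem card_one_descent_le (m l g : ℕ) (hl : l < m) :
    (Finset.univ.filter fun π : Equiv.Perm (Fin m) =>
        descentCount π = 1 ∧ (∀ i ∈ Finset.range m, DescentAt π i → i + 1 ≤ l) ∧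
          initialGaps π = g).card + (if g = 0 then l else 0) =
      ∑ i ∈ Finset.range l, i.choose g * (m - i).choose (g + 1) := by
  have heq : (Finset.univ.filter fun π : Equiv.Perm (Fin m) =>
      descentCount π = 1 ∧ (∀ i ∈ Finset.range m, DescentAt π i → i + 1 ≤ l) ∧
        initialGaps π = g) = (Finset.range l).biUnion fun i =>
      Finset.univ.filter fun π : Equiv.Perm (Fin m) =>
        (descentCount π = 1 ∧ DescentAt π i) ∧ initialGaps π = g := by
    ext π
    simp only [Finset.mem_filter, Finset.mem_univ, true_and, Finset.mem_biUnion]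
    constructor
    · rintro ⟨h1, h2, h3⟩
      obtain ⟨a, ha⟩ := Finset.card_eq_one.1 h1
      have hmem := Finset.mem_filter.1 (ha ▸ Finset.mem_singleton_self a)
      have := h2 a hmem.1 hmem.2
      exact ⟨a, Finset.mem_range.2 (by omega), ⟨h1, hmem.2⟩, h3⟩
    · rintro ⟨i, hi, ⟨h1, h2⟩, h3⟩
      refine ⟨h1, fun p _ hp => ?_, h3⟩
      have hi' := Finset.mem_range.1 hi
      have h := ((descentCount_eq_one_and_descentAt_iff h2.1).1 ⟨h1, h2⟩).1
      rw [h.eq_of_descentAt hp]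
      omega
  rw [heq, Finset.card_biUnion]
  · rw [Finset.sum_congr rfl fun i hi => (card_one_descent_at m i g (by
      have := Finset.mem_range.1 hi
      omega)).symm, Finset.sum_add_distrib]
    simp
  · intro i hi j hj hij
    refine Finset.disjoint_left.2 fun π hπ hπ' => hij ?_
    have h1 := (Finset.mem_filter.1 hπ).2.1
    have h2 := (Finset.mem_filter.1 hπ').2.1
    exact ((descentCount_eq_one_and_descentAt_iff h2.2.1).1 h2).1.eq_of_descentAt h1.2

theorem card_firstBlock {n l : ℕ} : (firstBlock n l).card = n - l - 1 := by
  rw [firstBlock, Fin.card_filter_val_lt]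
  omega

/-- The coefficients of a combination of the polynomials `t ↦ C(t + d - k, d)`, `k ≤ d`, are
determined by its values at the natural numbers. -/
theorem eq_of_sum_mul_choose_eq (d : ℕ) (f g : ℕ → ℕ)
    (h : ∀ t : ℕ, ∑ k ∈ Finset.range (d + 1), f k * (t + d - k).choose d =
      ∑ k ∈ Finset.range (d + 1), g k * (t + d - k).choose d) :
    ∀ k ≤ d, f k = g k := by
  have hsplit : ∀ (u : ℕ → ℕ) (k : ℕ), k ≤ d →
      ∑ i ∈ Finset.range (d + 1), u i * (k + d - i).choose d =
        ∑ i ∈ Finset.range k, u i * (k + d - i).choose d + u k := by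
    intro u k hk
    rw [← Finset.sum_subset (Finset.range_mono (show k + 1 ≤ d + 1 by omega)),
      Finset.sum_range_succ, Nat.add_sub_cancel_left, Nat.choose_self, mul_one]
    intro i hi hi'
    rw [Finset.mem_range] at hi hi'
    rw [Nat.choose_eq_zero_of_lt (by omega), mul_zero]
  intro k
  induction k using Nat.strong_induction_on with
  | _ k ih =>
    intro hk
    have h1 := h k
    rw [hsplit f k hk, hsplit g k hk, Finset.sum_congr rfl fun i hi => by
      rw [ih i (Finset.mem_range.1 hi) (by have := Finset.mem_range.1 hi; omega)]] at h1
    exact Nat.add_left_cancel h1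

/-- The numbers of subsets of `{0, …, d - 1}` with at most `l` elements and `k` runs. -/
def hStarCoeff (d l : ℕ) : ℕ → ℕ
  | 0 => 1
  | k + 1 => ∑ i ∈ Finset.range l, i.choose k * (d - i).choose (k + 1)

theorem sum_hStarCoeff_eq {n l : ℕ} (hl : l < n - 2) (t : ℕ) :
    (t + (n - 1)).choose (n - 1) + ∑ i ∈ Finset.range l,
        (t + (n - 2 - i)).choose (n - 2 - i) * (t + i).choose (i + 1) =
      ∑ k ∈ Finset.range (n - 1 + 1), hStarCoeff (n - 1) l k * (t + (n - 1) - k).choose (n - 1) := by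
  rw [Finset.sum_range_succ', add_comm]
  simp only [hStarCoeff, one_mul, Nat.sub_zero, Finset.sum_mul]
  rw [Finset.sum_comm]
  congr 1
  refine Finset.sum_congr rfl fun i hi => ?_
  have hi' := Finset.mem_range.1 hi
  rw [choose_mul_choose_eq_sum]
  rw [show n - 2 - i + i + 1 = n - 1 by omega, show n - 2 - i + 1 = n - 1 - i by omega]
  refine (Finset.sum_congr rfl fun k _ => ?_).trans
    (Finset.sum_subset (Finset.range_mono (show i + 1 ≤ n - 1 by omega)) fun k _ hk => ?_)
  · rw [show t + (n - 2 - i) + i - k = t + (n - 1) - (k + 1) by omega]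
  · rw [Finset.mem_range] at hk
    rw [Nat.choose_eq_zero_of_lt (show i < k by omega), zero_mul, zero_mul]

theorem sum_hStar_add_correction {n l : ℕ} (hl : l < n - 2) (hm : 1 ≤ n - 1) {h : ℕ → ℕ}
    (hh : IsHStarVector (MklPolytope n 1 l) (n - 1) h) (t : ℕ) :
    ∑ k ∈ Finset.range (n - 1 + 1),
        (h k + if k = 1 then l + 1 else 0) * (t + (n - 1) - k).choose (n - 1) =
      (t + (n - 1)).choose (n - 1) + ∑ i ∈ Finset.range l,
        (t + (n - 2 - i)).choose (n - 2 - i) * (t + i).choose (i + 1) := by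
  have hs : (firstBlock n l).card = n - 2 - l + 1 := by rw [card_firstBlock]; omega
  have hs' : (firstBlock n l)ᶜ.card = l + 1 := by
    rw [Finset.card_compl, hs, Fintype.card_fin]; omega
  have h1 : latticeCount ((t : ℝ) • MklPolytope n 1 l) +
      (l + 1) * (t + (n - 2 - l + l)).choose (n - 2 - l + l + 1) =
      ∑ a ∈ Finset.range (t + 1),
        (a + (n - 2 - l)).choose (n - 2 - l) * (2 * t - a + l).choose l := by
    rw [latticeCount_smul_MklPolytope hl]
    convert card_filter_piAntidiag_block_le (firstBlock n l) (n - 2 - l) l t hs hs'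
  rw [hh.1 t, sum_choose_mul_choose_eq] at h1
  rw [show n - 2 - l + l + 1 = n - 1 by omega, show n - 2 - l + l = n - 2 by omega] at h1
  rw [← h1]
  simp only [add_mul, Finset.sum_add_distrib, ite_mul, zero_mul]
  rw [Finset.sum_ite_eq' (Finset.range (n - 1 + 1)) 1, if_pos (Finset.mem_range.2 (by omega)),
    show t + (n - 1) - 1 = t + (n - 2) by omega]

/-- Let `M = M_n[1,ℓ]` be a rank-2 Schubert matroid with `n ≥ 4` and
`1 ≤ ℓ < n - 2`.  The `h*`-vector of `P_M` satisfies `h*₀ = 1`,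
`h*₀ + h*₁ = #{π ∈ P_{1,n-1} : d(π) ≤ ℓ, ig(π) = 0}` and, for every `k ≥ 2`,
`h*_k = #{π ∈ P_{1,n-1} : d(π) ≤ ℓ, ig(π) = k - 1}`.  (Here the descent position
`d(π)` is 1-based: a descent at 0-based position `i` is at `d(π) = i + 1`.) -/
theorem hstar_schubert_rank_two (n l : ℕ) (hn : 4 ≤ n) (hl : 1 ≤ l) (hl2 : l < n - 2)
    (h : ℕ → ℕ) (hh : IsHStarVector (MklPolytope n 1 l) (n - 1) h) :
    h 0 = 1 ∧
    (h 0 + h 1 = (Finset.univ.filter fun π : Equiv.Perm (Fin (n - 1)) =>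
        descentCount π = 1 ∧ (∀ i ∈ Finset.range (n - 1), DescentAt π i → i + 1 ≤ l) ∧
          initialGaps π = 0).card) ∧
    ∀ k : ℕ, 2 ≤ k →
      h k = (Finset.univ.filter fun π : Equiv.Perm (Fin (n - 1)) =>
        descentCount π = 1 ∧ (∀ i ∈ Finset.range (n - 1), DescentAt π i → i + 1 ≤ l) ∧
          initialGaps π = k - 1).card := by
  have hm : 1 ≤ n - 1 := by omega
  have key := eq_of_sum_mul_choose_eq (n - 1) _ _ fun t =>
    (sum_hStar_add_correction hl2 hm hh t).trans (sum_hStarCoeff_eq hl2 t)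
  have hcount : ∀ g, (Finset.univ.filter fun π : Equiv.Perm (Fin (n - 1)) =>
      descentCount π = 1 ∧ (∀ i ∈ Finset.range (n - 1), DescentAt π i → i + 1 ≤ l) ∧
        initialGaps π = g).card + (if g = 0 then l else 0) =
      ∑ i ∈ Finset.range l, i.choose g * (n - 1 - i).choose (g + 1) := fun g => by
    convert card_one_descent_le (n - 1) l g (by omega)
  have h0 := key 0 (Nat.zero_le _)
  have h1 := key 1 hm
  have hc0 := hcount 0
  simp only [zero_ne_one, if_false, if_true, hStarCoeff, add_zero] at h0 h1 hc0
  refine ⟨h0, by omega, fun k hk => ?_⟩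
  obtain ⟨g, rfl⟩ := Nat.exists_eq_add_of_le' (show 1 ≤ k by omega)
  have hcg := hcount g
  rw [if_neg (by omega), add_zero] at hcg
  rw [Nat.add_sub_cancel, hcg]
  by_cases hg : g + 1 ≤ n - 1
  · have hkg := key (g + 1) hg
    rwa [if_neg (by omega), add_zero] at hkg
  · rw [hh.2 _ (by omega), Finset.sum_eq_zero]
    intro i hi
    have := Finset.mem_range.1 hi
    rw [Nat.choose_eq_zero_of_lt (by omega), zero_mul]
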